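/- Let n ≥ 1, let W be a real n×n matrix with ‖I − W‖_∞ < 1, let b ∈ ℝⁿ, and let H_p be the partition matrix of a partition p of {1,…,n}. Then there exists exactly one x* ∈ ℝⁿ satisfying the fixed-point equation x* = max(0, (I − W)·H_p·x* + b) (componentwise), and for every initial vector x(0) ∈ ℝⁿ the sequence generated by x(t+1) = max(0, (I − W)H_p x(t) + b) converges to this unique x*; in particular the limit is independent of the initial condition. -/

import Mathlib

open Matrix Filter

/-- The size of the block of the partition (equivalence relation) `p` containing `i`. -/
noncomputable def blockSize {n : ℕ} (p : Setoid (Fin n)) (i : Fin n) : ℕ :=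
  Set.ncard {k | p.r i k}

open Classical in
/-- The partition matrix `H_p` of a partition `p` of `{1,…,n}`:
`(H_p)_{ij} = 1/l_i` if `i` and `j` lie in the same block of `p` (`l_i` the cardinality of
the block containing `i`), and `(H_p)_{ij} = 0` otherwise. -/
noncomputable def partitionMatrix {n : ℕ} (p : Setoid (Fin n)) : Matrix (Fin n) (Fin n) ℝ :=
  Matrix.of fun i j => if p.r i j then (1 : ℝ) / (blockSize p i : ℝ) else 0

/-- The operator norm on `n × n` real matrices induced by the supremum norm on `ℝⁿ`,
i.e. the maximum absolute row sum. -/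
noncomputable def rowSumNorm {n : ℕ} (A : Matrix (Fin n) (Fin n) ℝ) : ℝ :=
  ⨆ i, ∑ j, |A i j|

lemma rowSumNorm_nonneg {n : ℕ} (A : Matrix (Fin n) (Fin n) ℝ) : 0 ≤ rowSumNorm A :=
  Real.iSup_nonneg fun _ => Finset.sum_nonneg fun _ _ => abs_nonneg _

lemma sum_abs_le_rowSumNorm {n : ℕ} (A : Matrix (Fin n) (Fin n) ℝ) (i : Fin n) :
    ∑ j, |A i j| ≤ rowSumNorm A :=
  le_ciSup (f := fun i => ∑ j, |A i j|) (Set.finite_range _).bddAbove i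

lemma norm_mulVec_le_rowSumNorm_mul {n : ℕ} (A : Matrix (Fin n) (Fin n) ℝ) (v : Fin n → ℝ) :
    ‖A.mulVec v‖ ≤ rowSumNorm A * ‖v‖ := by
  refine (pi_norm_le_iff_of_nonneg (mul_nonneg (rowSumNorm_nonneg A) (norm_nonneg v))).2
    fun i => ?_
  calc ‖A.mulVec v i‖ ≤ ∑ j, ‖A i j * v j‖ := norm_sum_le Finset.univ fun j => A i j * v j
    _ ≤ ∑ j, |A i j| * ‖v‖ := by
        gcongr with j
        rw [norm_mul, Real.norm_eq_abs]
        gcongr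
        exact norm_le_pi_norm v j
    _ = (∑ j, |A i j|) * ‖v‖ := (Finset.sum_mul ..).symm
    _ ≤ rowSumNorm A * ‖v‖ := by
        gcongr
        exact sum_abs_le_rowSumNorm A i

lemma rowSumNorm_partitionMatrix_le_one {n : ℕ} (p : Setoid (Fin n)) :
    rowSumNorm (partitionMatrix p) ≤ 1 := by
  classical
  refine Real.iSup_le (fun i => ?_) zero_le_one
  have hcard : blockSize p i = (Finset.univ.filter fun k => p.r i k).card := by
    rw [blockSize, ← Set.ncard_coe_finset]
    simp
  have habs : ∀ j, |partitionMatrix p i j| =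
      if p.r i j then (1 : ℝ) / (blockSize p i : ℝ) else 0 := fun j => by
    rw [partitionMatrix, Matrix.of_apply]
    split_ifs
    · exact abs_of_nonneg (by positivity)
    · exact abs_zero
  simp_rw [habs]
  rw [← Finset.sum_filter, Finset.sum_const, ← hcard, nsmul_eq_mul, mul_one_div]
  exact div_self_le_one _

/-- The best response map contracts the supremum norm by the factor `rowSumNorm (1 - W)`. -/
lemma contractingWith_bestResponse {n : ℕ} (W : Matrix (Fin n) (Fin n) ℝ)
    (hW : rowSumNorm (1 - W) < 1) (b : Fin n → ℝ) (p : Setoid (Fin n)) :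
    ContractingWith ⟨rowSumNorm (1 - W), rowSumNorm_nonneg _⟩ fun (x : Fin n → ℝ) i =>
      max 0 (((1 - W) * partitionMatrix p).mulVec x i + b i) := by
  refine ⟨hW, LipschitzWith.of_dist_le_mul fun x y => ?_⟩
  have hK := rowSumNorm_nonneg (1 - W)
  refine (dist_pi_le_iff (mul_nonneg hK dist_nonneg)).2 fun i => ?_
  calc dist (max 0 (((1 - W) * partitionMatrix p).mulVec x i + b i))
        (max 0 (((1 - W) * partitionMatrix p).mulVec y i + b i))
      ≤ |((1 - W) * partitionMatrix p).mulVec x i + b i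
          - (((1 - W) * partitionMatrix p).mulVec y i + b i)| := by
        rw [Real.dist_eq, max_comm 0, max_comm 0]
        exact abs_max_sub_max_le_abs _ _ _
    _ = ‖(1 - W).mulVec ((partitionMatrix p).mulVec (x - y)) i‖ := by
        rw [Matrix.mulVec_mulVec, Matrix.mulVec_sub, add_sub_add_right_eq_sub, Pi.sub_apply,
          Real.norm_eq_abs]
    _ ≤ ‖(1 - W).mulVec ((partitionMatrix p).mulVec (x - y))‖ := norm_le_pi_norm _ i
    _ ≤ rowSumNorm (1 - W) * ‖(partitionMatrix p).mulVec (x - y)‖ :=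
        norm_mulVec_le_rowSumNorm_mul _ _
    _ ≤ rowSumNorm (1 - W) * (1 * ‖x - y‖) := by
        gcongr
        refine (norm_mulVec_le_rowSumNorm_mul _ _).trans ?_
        gcongr
        exact rowSumNorm_partitionMatrix_le_one p
    _ = rowSumNorm (1 - W) * dist x y := by rw [one_mul, dist_eq_norm]

/-- There is a unique fixed point of `x ↦ max (0, (I − W) H_p x + b)`, and every trajectory of
the best response dynamics converges to it, independently of the initial condition. -/
theorem bestResponse_unique_equilibrium {n : ℕ} (hn : 1 ≤ n) (W : Matrix (Fin n) (Fin n) ℝ)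
    (hW : rowSumNorm (1 - W) < 1) (b : Fin n → ℝ) (p : Setoid (Fin n)) :
    ∃ xs : Fin n → ℝ,
      (xs = fun i => max 0 (((1 - W) * partitionMatrix p).mulVec xs i + b i)) ∧
      (∀ y : Fin n → ℝ,
        (y = fun i => max 0 (((1 - W) * partitionMatrix p).mulVec y i + b i)) → y = xs) ∧
      (∀ x : ℕ → Fin n → ℝ,
        (∀ t, x (t + 1) = fun i => max 0 (((1 - W) * partitionMatrix p).mulVec (x t) i + b i)) →
        Tendsto x atTop (nhds xs)) := by
  have hf := contractingWith_bestResponse W hW b p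
  refine ⟨hf.fixedPoint, hf.fixedPoint_isFixedPt.symm,
    fun y hy => hf.fixedPoint_unique hy.symm, fun x hx => ?_⟩
  convert hf.tendsto_iterate_fixedPoint (x 0) using 1
  funext t
  induction t with
  | zero => rfl
  | succ t ih => rw [hx t, Function.iterate_succ_apply', ← ih]
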